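/- (Out-focus point) Let f, g : Fin n → ℝ with ∑ᵢ fᵢ = 1, ∑ᵢ gᵢ = 1, fᵢ > 0 and gᵢ ≥ 0 for all i, and suppose D_{fg} := ‖x̄_f − x̄_g‖² > 0. Set b := Δ_f − Δ_g − D_{fg} and ε₊ := (b + √(b² + 4 Δ_f D_{fg}))/(2 D_{fg}), and let a₊ := x̄_f + ε₊ • (x̄_f − x̄_g). Then a₊ is the unique global maximizer of the relative dispersion: δ(a₊) > δ(a) for every a ∈ E with a ≠ a₊. -/

import Mathlib

open Finset

noncomputable def centroid {E : Type*} [NormedAddCommGroup E] [InnerProductSpace ℝ E]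
    {n : ℕ} (x : Fin n → E) (w : Fin n → ℝ) : E :=
  ∑ i, w i • x i

noncomputable def inertiaAt {E : Type*} [NormedAddCommGroup E] [InnerProductSpace ℝ E]
    {n : ℕ} (x : Fin n → E) (w : Fin n → ℝ) (a : E) : ℝ :=
  ∑ i, w i * ‖x i - a‖ ^ 2

noncomputable def inertia {E : Type*} [NormedAddCommGroup E] [InnerProductSpace ℝ E]
    {n : ℕ} (x : Fin n → E) (w : Fin n → ℝ) : ℝ :=
  inertiaAt x w (centroid x w)

noncomputable def relDisp {E : Type*} [NormedAddCommGroup E] [InnerProductSpace ℝ E]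
    {n : ℕ} (x : Fin n → E) (g f : Fin n → ℝ) (a : E) : ℝ :=
  inertiaAt x g a / inertiaAt x f a

/-- The parallel axis theorem for weighted families of total mass one. -/
theorem inertiaAt_eq_inertia_add {E : Type*} [NormedAddCommGroup E] [InnerProductSpace ℝ E]
    {n : ℕ} (x : Fin n → E) (w : Fin n → ℝ) (hw : ∑ i, w i = 1) (a : E) :
    inertiaAt x w a = inertia x w + ‖centroid x w - a‖ ^ 2 := by
  have hcross : ∑ i, w i * inner ℝ (x i - centroid x w) (centroid x w - a) = 0 := by
    simp only [← real_inner_smul_left, ← sum_inner, smul_sub, sum_sub_distrib, ← sum_smul, hw,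
      one_smul]
    rw [← _root_.centroid, sub_self, inner_zero_left]
  have hterm : ∀ i, w i * ‖x i - a‖ ^ 2 = w i * ‖x i - centroid x w‖ ^ 2 +
      2 * (w i * inner ℝ (x i - centroid x w) (centroid x w - a)) +
      w i * ‖centroid x w - a‖ ^ 2 := fun i ↦ by
    rw [← sub_add_sub_cancel (x i) (centroid x w) a, norm_add_sq_real]
    ring
  rw [inertia, inertiaAt, inertiaAt, sum_congr rfl fun i _ ↦ hterm i, sum_add_distrib,
    sum_add_distrib, ← mul_sum, hcross, ← sum_mul, hw]
  ring

theorem inertia_pos_of_centroid_ne {E : Type*} [NormedAddCommGroup E] [InnerProductSpace ℝ E]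
    {n : ℕ} (x : Fin n → E) (f g : Fin n → ℝ) (hg : ∑ i, g i = 1) (hf : ∀ i, 0 < f i)
    (h : centroid x f ≠ centroid x g) : 0 < inertia x f := by
  have hnonneg : ∀ i ∈ univ, 0 ≤ f i * ‖x i - centroid x f‖ ^ 2 :=
    fun i _ ↦ mul_nonneg (hf i).le (sq_nonneg _)
  refine lt_of_le_of_ne (sum_nonneg hnonneg) fun h0 ↦ h ?_
  have hx : ∀ i, x i = centroid x f := fun i ↦ by
    have hi := (sum_eq_zero_iff_of_nonneg hnonneg).1 h0.symm i (mem_univ i)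
    simpa [(hf i).ne', sub_eq_zero] using hi
  calc centroid x f = ∑ i, g i • centroid x f := by rw [← sum_smul, hg, one_smul]
    _ = centroid x g := sum_congr rfl fun i _ ↦ by rw [hx i]

/-- The larger root of `D t² - b t - c`, for `c, D > 0`, is positive. -/
theorem larger_root_pos_and_eq {b c D : ℝ} (hc : 0 < c) (hD : 0 < D) :
    0 < (b + √(b ^ 2 + 4 * c * D)) / (2 * D) ∧
      D * ((b + √(b ^ 2 + 4 * c * D)) / (2 * D)) ^ 2 =
        b * ((b + √(b ^ 2 + 4 * c * D)) / (2 * D)) + c := by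
  have hcD : 0 < c * D := mul_pos hc hD
  have hsq : √(b ^ 2 + 4 * c * D) ^ 2 = b ^ 2 + 4 * c * D := Real.sq_sqrt (by nlinarith)
  have hlt : |b| < √(b ^ 2 + 4 * c * D) :=
    Real.lt_sqrt_of_sq_lt (by rw [sq_abs]; linarith)
  refine ⟨div_pos (by linarith [neg_abs_le b]) (by linarith), ?_⟩
  generalize √(b ^ 2 + 4 * c * D) = s at hsq ⊢
  field_simp
  linear_combination hsq

/-- The out-focus point `a₊ = x̄_f + ε₊ (x̄_f − x̄_g)`, with
`ε₊ = (b + √(b² + 4 Δ_f D_{fg}))/(2 D_{fg})` and `b = Δ_f − Δ_g − D_{fg}`, is the unique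
global maximizer of the relative dispersion. -/
theorem outFocus_unique_max {E : Type*} [NormedAddCommGroup E] [InnerProductSpace ℝ E]
    {n : ℕ} (x : Fin n → E) (f g : Fin n → ℝ)
    (hf : ∑ i, f i = 1) (hg : ∑ i, g i = 1)
    (hfpos : ∀ i, 0 < f i) (hgnonneg : ∀ i, 0 ≤ g i)
    (hD : 0 < ‖centroid x f - centroid x g‖ ^ 2) :
    ∀ a : E,
      a ≠ centroid x f +
        (((inertia x f - inertia x g - ‖centroid x f - centroid x g‖ ^ 2) +
            Real.sqrt ((inertia x f - inertia x g - ‖centroid x f - centroid x g‖ ^ 2) ^ 2 +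
              4 * inertia x f * ‖centroid x f - centroid x g‖ ^ 2)) /
          (2 * ‖centroid x f - centroid x g‖ ^ 2)) • (centroid x f - centroid x g) →
      relDisp x g f a <
        relDisp x g f (centroid x f +
          (((inertia x f - inertia x g - ‖centroid x f - centroid x g‖ ^ 2) +
              Real.sqrt ((inertia x f - inertia x g - ‖centroid x f - centroid x g‖ ^ 2) ^ 2 +
                4 * inertia x f * ‖centroid x f - centroid x g‖ ^ 2)) /
            (2 * ‖centroid x f - centroid x g‖ ^ 2)) • (centroid x f - centroid x g)) := by
  intro a ha
  have hF := inertia_pos_of_centroid_ne x f g hg hfpos fun h ↦ by simp [h] at hD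
  obtain ⟨hε, hroot⟩ := larger_root_pos_and_eq
    (b := inertia x f - inertia x g - ‖centroid x f - centroid x g‖ ^ 2) hF hD
  set ε := ((inertia x f - inertia x g - ‖centroid x f - centroid x g‖ ^ 2) +
    √((inertia x f - inertia x g - ‖centroid x f - centroid x g‖ ^ 2) ^ 2 +
      4 * inertia x f * ‖centroid x f - centroid x g‖ ^ 2)) /
    (2 * ‖centroid x f - centroid x g‖ ^ 2)
  have hfpt : ∀ y, 0 < inertiaAt x f y := fun y ↦ by
    rw [inertiaAt_eq_inertia_add x f hf]
    positivity
  have key : ∀ y, ε * inertiaAt x g y = (1 + ε) * inertiaAt x f y -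
      ‖y - (centroid x f + ε • (centroid x f - centroid x g))‖ ^ 2 := fun y ↦ by
    have hy : centroid x g - y =
        -((y - centroid x f) + (centroid x f - centroid x g)) := by abel
    rw [inertiaAt_eq_inertia_add x f hf, inertiaAt_eq_inertia_add x g hg, hy, norm_neg,
      norm_add_sq_real, norm_sub_rev (centroid x f) y, ← sub_sub y, norm_sub_sq_real (y - _),
      real_inner_smul_right, norm_smul, mul_pow, Real.norm_eq_abs, sq_abs]
    linear_combination hroot
  have hmax := key (centroid x f + ε • (centroid x f - centroid x g))
  rw [sub_self, norm_zero] at hmax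
  have hdist : 0 < ‖a - (centroid x f + ε • (centroid x f - centroid x g))‖ ^ 2 :=
    pow_pos (norm_pos_iff.2 (sub_ne_zero.2 ha)) 2
  calc relDisp x g f a < (1 + ε) / ε := by
        rw [relDisp, div_lt_div_iff₀ (hfpt a) hε]
        linarith [key a]
    _ = relDisp x g f (centroid x f + ε • (centroid x f - centroid x g)) := by
        rw [relDisp, div_eq_div_iff hε.ne' (hfpt _).ne']
        linarith
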